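/- In the implicative model of set theory, there exist s1, s2, s3 ∈ Σ realizing the compatibility of equality with membership and transitivity: s1 ≤ ⋀_{α,β,γ∈W}((α =_W β) × (γ ∈_W α) → γ ∈_W β), s2 ≤ ⋀_{α,β,γ∈W}((α =_W β) × (α ∈_W γ) → β ∈_W γ), and s3 ≤ ⋀_{α,β,γ∈W}((α =_W β) × (γ =_W α) → γ =_W β). -/

import Mathlib

universe u v

/-- An implicative algebra: a complete lattice with an implication antitone in the
first argument, monotone in the second, distributing over arbitrary meets in the
second argument, together with a separator `Sep` which is upward closed, closed
under modus ponens, and contains the combinators K and S. -/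
structure ImplicativeAlgebra (A : Type u) [CompleteLattice A] where
  imp : A → A → A
  imp_anti : ∀ ⦃a a' b : A⦄, a ≤ a' → imp a' b ≤ imp a b
  imp_mono : ∀ ⦃a b b' : A⦄, b ≤ b' → imp a b ≤ imp a b'
  imp_sInf : ∀ (a : A) (S : Set A), imp a (sInf S) = ⨅ b ∈ S, imp a b
  Sep : Set A
  sep_upward : ∀ ⦃a b : A⦄, a ∈ Sep → a ≤ b → b ∈ Sep
  sep_mp : ∀ ⦃a b : A⦄, imp a b ∈ Sep → a ∈ Sep → b ∈ Sep
  sep_K : (⨅ a : A, ⨅ b : A, imp a (imp b a)) ∈ Sep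
  sep_S : (⨅ a : A, ⨅ b : A, ⨅ c : A,
      imp (imp a (imp b c)) (imp (imp a b) (imp a c))) ∈ Sep

namespace ImplicativeAlgebra

variable {A : Type u} [CompleteLattice A] (𝔸 : ImplicativeAlgebra A)

/-- Application: `a · b := ⋀ {x | a ≤ b → x}`. -/
def app (a b : A) : A := sInf {x : A | a ≤ 𝔸.imp b x}

/-- Implicative conjunction `a × b`. -/
def itimes (a b : A) : A := ⨅ x : A, 𝔸.imp (𝔸.imp a (𝔸.imp b x)) x

/-- Implicative disjunction `a + b`. -/
def iplus (a b : A) : A := ⨅ x : A, 𝔸.imp (𝔸.imp a x) (𝔸.imp (𝔸.imp b x) x)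

/-- Second-order encoding of the existential quantifier. -/
def iexists {ι : Sort v} (f : ι → A) : A := ⨅ x : A, 𝔸.imp (⨅ i, 𝔸.imp (f i) x) x

/-- Encoding of k = λx.λy.x. -/
def kComb : A := ⨅ a : A, 𝔸.imp a (⨅ b : A, 𝔸.imp b a)

/-- Encoding of λx.λy.y. -/
def kbarComb : A := ⨅ a : A, 𝔸.imp a (⨅ b : A, 𝔸.imp b b)

/-- Encoding of the pairing combinator p = λx.λy.λz.zxy. -/
def pComb : A := ⨅ a : A, 𝔸.imp a (⨅ b : A, 𝔸.imp b (⨅ c : A, 𝔸.imp c (𝔸.app (𝔸.app c a) b)))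

/-- Encoding of the first projection p₁ = λu.u k. -/
def p1Comb : A := ⨅ u : A, 𝔸.imp u (𝔸.app u 𝔸.kComb)

/-- Encoding of the second projection p₂ = λv.v k̄. -/
def p2Comb : A := ⨅ u : A, 𝔸.imp u (𝔸.app u 𝔸.kbarComb)

/-- Encoding of the existential-introduction combinator e = λx.λz.zx. -/
def eComb : A := ⨅ a : A, 𝔸.imp a (⨅ c : A, 𝔸.imp c (𝔸.app c a))

end ImplicativeAlgebra

/-- Names of the implicative model of set theory: a name is a (set-indexed)
family of previously constructed names, each labelled by a truth value in `A`
(a partial function from names to `A`, presented as a family). -/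
inductive Name (A : Type u) : Type (u + 1)
  | mk (ι : Type u) (elem : ι → Name A) (val : ι → A) : Name A

namespace Name

/-- The (index set of the) domain of a name. -/
def idx {A : Type u} : Name A → Type u
  | .mk ι _ _ => ι

/-- The elements of the domain of a name. -/
def elem {A : Type u} : (α : Name A) → α.idx → Name A
  | .mk _ e _ => e

/-- The truth value attached to each element of the domain of a name. -/
def val {A : Type u} : (α : Name A) → α.idx → A
  | .mk _ _ v => v

variable {A : Type u} [CompleteLattice A]

/-- `eqPair 𝔸 α β = (α ⊆_W β, β ⊆_W α)`, defined by simultaneous recursion,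
where `α ⊆_W β := ⋀_{t ∈ dom α}(α(t) → t ∈_W β)` and
`t ∈_W β := ∃_{u ∈ dom β}(β(u) × (u =_W t))` and `u =_W t := (u ⊆_W t) × (t ⊆_W u)`. -/
def eqPair (𝔸 : ImplicativeAlgebra A) : Name A → Name A → A × A
  | .mk _ e v, .mk _ e' v' =>
    (⨅ i, 𝔸.imp (v i) (𝔸.iexists fun j => 𝔸.itimes (v' j)
        (𝔸.itimes (eqPair 𝔸 (e i) (e' j)).2 (eqPair 𝔸 (e i) (e' j)).1)),
     ⨅ j, 𝔸.imp (v' j) (𝔸.iexists fun i => 𝔸.itimes (v i)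
        (𝔸.itimes (eqPair 𝔸 (e i) (e' j)).1 (eqPair 𝔸 (e i) (e' j)).2)))

/-- `α ⊆_W β`. -/
def subW (𝔸 : ImplicativeAlgebra A) (α β : Name A) : A := (eqPair 𝔸 α β).1

/-- `α =_W β := (α ⊆_W β) × (β ⊆_W α)`. -/
def eqW (𝔸 : ImplicativeAlgebra A) (α β : Name A) : A :=
  𝔸.itimes (eqPair 𝔸 α β).1 (eqPair 𝔸 α β).2

/-- `α ∈_W β := ∃_{t ∈ dom β}(β(t) × (t =_W α))`. -/
def memW (𝔸 : ImplicativeAlgebra A) (α β : Name A) : A :=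
  𝔸.iexists fun j : β.idx => 𝔸.itimes (β.val j) (eqW 𝔸 (β.elem j) α)

end Name

namespace ImplicativeAlgebra

variable {A : Type u} [CompleteLattice A] (𝔸 : ImplicativeAlgebra A)

theorem app_le_iff {a b c : A} : 𝔸.app a b ≤ c ↔ a ≤ 𝔸.imp b c := by
  refine ⟨fun h => le_trans ?_ (𝔸.imp_mono h), fun h => sInf_le h⟩
  rw [app, 𝔸.imp_sInf]
  exact le_iInf₂ fun _ hx => hx

theorem imp_iInf {ι : Sort v} (a : A) (f : ι → A) : 𝔸.imp a (⨅ i, f i) = ⨅ i, 𝔸.imp a (f i) := by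
  rw [iInf, 𝔸.imp_sInf, iInf_range]

theorem app_mem {a b : A} (ha : a ∈ 𝔸.Sep) (hb : b ∈ 𝔸.Sep) : 𝔸.app a b ∈ 𝔸.Sep :=
  𝔸.sep_mp (𝔸.sep_upward ha (𝔸.app_le_iff.1 le_rfl)) hb

/-- The combinator K, as the principal type of `λx.λy.x`. -/
def cK : A := ⨅ a : A, ⨅ b : A, 𝔸.imp a (𝔸.imp b a)

/-- The combinator S, as the principal type of `λx.λy.λz.xz(yz)`. -/
def cS : A := ⨅ a : A, ⨅ b : A, ⨅ c : A,
  𝔸.imp (𝔸.imp a (𝔸.imp b c)) (𝔸.imp (𝔸.imp a b) (𝔸.imp a c))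

theorem cK_le (a b : A) : 𝔸.cK ≤ 𝔸.imp a (𝔸.imp b a) :=
  (iInf_le _ a).trans (iInf_le _ b)

theorem cS_le (a b c : A) :
    𝔸.cS ≤ 𝔸.imp (𝔸.imp a (𝔸.imp b c)) (𝔸.imp (𝔸.imp a b) (𝔸.imp a c)) :=
  ((iInf_le _ a).trans (iInf_le _ b)).trans (iInf_le _ c)

/-- The constant realizer `λx.r`. -/
def const (r : A) : A := 𝔸.app 𝔸.cK r

/-- The realizer `λx.rx(qx)`. -/
def ap (r q : A) : A := 𝔸.app (𝔸.app 𝔸.cS r) q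

/-- The realizer `λx.r(qx)`. -/
def comp (r q : A) : A := 𝔸.ap (𝔸.const r) q

/-- The identity realizer `λx.x`. -/
def ident : A := 𝔸.ap 𝔸.cK 𝔸.cK

/-- The realizer `λx.λk.kx`. -/
def evalAt : A := 𝔸.comp (𝔸.app 𝔸.cS 𝔸.ident) 𝔸.cK

/-- The pairing realizer `λx.λy.λk.kxy`. -/
def mkPair : A :=
  𝔸.ap (𝔸.comp 𝔸.cS (𝔸.comp 𝔸.cK (𝔸.comp 𝔸.cS 𝔸.evalAt))) (𝔸.const 𝔸.cK)

/-- The realizer `λx.⟨rx, qx⟩`. -/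
def pair (r q : A) : A := 𝔸.ap (𝔸.comp 𝔸.mkPair r) q

/-- The realizer of the first projection out of a conjunction. -/
def fst : A := 𝔸.ap 𝔸.ident (𝔸.const 𝔸.cK)

/-- The realizer of the second projection out of a conjunction. -/
def snd : A := 𝔸.ap 𝔸.ident (𝔸.const (𝔸.const 𝔸.ident))

/-- The realizer `λx.λy.r⟨x, y⟩`. -/
def curry (r : A) : A := 𝔸.comp (𝔸.app 𝔸.cS (𝔸.const r)) 𝔸.mkPair

/-- The realizer `λx.r(xx)`. -/
def selfApp (r : A) : A := 𝔸.comp r (𝔸.ap 𝔸.ident 𝔸.ident)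

/-- A fixed point of `r`. -/
def fixpoint (r : A) : A := 𝔸.app (𝔸.selfApp r) (𝔸.selfApp r)

section Sep

variable {𝔸} {r q : A}

@[simp] theorem cK_mem : 𝔸.cK ∈ 𝔸.Sep := 𝔸.sep_K

@[simp] theorem cS_mem : 𝔸.cS ∈ 𝔸.Sep := 𝔸.sep_S

@[simp] theorem const_mem (hr : r ∈ 𝔸.Sep) : 𝔸.const r ∈ 𝔸.Sep := 𝔸.app_mem cK_mem hr

@[simp] theorem ap_mem (hr : r ∈ 𝔸.Sep) (hq : q ∈ 𝔸.Sep) : 𝔸.ap r q ∈ 𝔸.Sep :=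
  𝔸.app_mem (𝔸.app_mem cS_mem hr) hq

@[simp] theorem comp_mem (hr : r ∈ 𝔸.Sep) (hq : q ∈ 𝔸.Sep) : 𝔸.comp r q ∈ 𝔸.Sep :=
  ap_mem (const_mem hr) hq

@[simp] theorem ident_mem : 𝔸.ident ∈ 𝔸.Sep := ap_mem cK_mem cK_mem

@[simp] theorem evalAt_mem : 𝔸.evalAt ∈ 𝔸.Sep :=
  comp_mem (𝔸.app_mem cS_mem ident_mem) cK_mem

@[simp] theorem mkPair_mem : 𝔸.mkPair ∈ 𝔸.Sep := by simp (maxDischargeDepth := 20) [mkPair]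

@[simp] theorem pair_mem (hr : r ∈ 𝔸.Sep) (hq : q ∈ 𝔸.Sep) : 𝔸.pair r q ∈ 𝔸.Sep := by
  simp [pair, hr, hq]

@[simp] theorem fst_mem : 𝔸.fst ∈ 𝔸.Sep := by simp [fst]

@[simp] theorem snd_mem : 𝔸.snd ∈ 𝔸.Sep := by simp (maxDischargeDepth := 20) [snd]

@[simp] theorem curry_mem (hr : r ∈ 𝔸.Sep) : 𝔸.curry r ∈ 𝔸.Sep :=
  comp_mem (𝔸.app_mem cS_mem (const_mem hr)) mkPair_mem

@[simp] theorem fixpoint_mem (hr : r ∈ 𝔸.Sep) : 𝔸.fixpoint r ∈ 𝔸.Sep := by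
  have h : 𝔸.selfApp r ∈ 𝔸.Sep := by simp [selfApp, hr]
  exact 𝔸.app_mem h h

end Sep

section Rules

variable {𝔸} {r q g a b c x : A}

theorem const_le (h : r ≤ a) : 𝔸.const r ≤ 𝔸.imp g a :=
  𝔸.app_le_iff.2 ((𝔸.cK_le a g).trans (𝔸.imp_anti h))

theorem app_cS_le (hr : r ≤ 𝔸.imp g (𝔸.imp a b)) :
    𝔸.app 𝔸.cS r ≤ 𝔸.imp (𝔸.imp g a) (𝔸.imp g b) :=
  𝔸.app_le_iff.2 ((𝔸.cS_le g a b).trans (𝔸.imp_anti hr))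

theorem ap_le (hr : r ≤ 𝔸.imp g (𝔸.imp a b)) (hq : q ≤ 𝔸.imp g a) : 𝔸.ap r q ≤ 𝔸.imp g b :=
  𝔸.app_le_iff.2 ((app_cS_le hr).trans (𝔸.imp_anti hq))

theorem comp_le (hr : r ≤ 𝔸.imp a b) (hq : q ≤ 𝔸.imp g a) : 𝔸.comp r q ≤ 𝔸.imp g b :=
  ap_le (const_le hr) hq

theorem ident_le : 𝔸.ident ≤ 𝔸.imp a a :=
  ap_le (𝔸.cK_le a (𝔸.imp a a)) (𝔸.cK_le a a)

theorem evalAt_le : 𝔸.evalAt ≤ 𝔸.imp a (𝔸.imp (𝔸.imp a b) b) :=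
  comp_le (app_cS_le ident_le) (𝔸.cK_le a (𝔸.imp a b))

theorem mkPair_le : 𝔸.mkPair ≤ 𝔸.imp a (𝔸.imp b (𝔸.itimes a b)) := by
  simp only [itimes, imp_iInf]
  refine le_iInf fun x => ap_le (a := 𝔸.imp b (𝔸.imp (𝔸.imp a (𝔸.imp b x)) b)) ?_
    (const_le (𝔸.cK_le _ _))
  refine comp_le (𝔸.cS_le _ _ _) (comp_le (𝔸.cK_le _ _) (comp_le (𝔸.cS_le _ _ _) ?_))
  exact evalAt_le

theorem pair_le (hr : r ≤ 𝔸.imp g a) (hq : q ≤ 𝔸.imp g b) :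
    𝔸.pair r q ≤ 𝔸.imp g (𝔸.itimes a b) :=
  ap_le (comp_le mkPair_le hr) hq

theorem fst_le : 𝔸.fst ≤ 𝔸.imp (𝔸.itimes a b) a :=
  ap_le (ident_le.trans (𝔸.imp_mono (iInf_le _ a))) (const_le (𝔸.cK_le a b))

theorem snd_le : 𝔸.snd ≤ 𝔸.imp (𝔸.itimes a b) b :=
  ap_le (ident_le.trans (𝔸.imp_mono (iInf_le _ b))) (const_le (const_le ident_le))

theorem comp_fst_le (h : r ≤ 𝔸.imp g (𝔸.itimes a b)) : 𝔸.comp 𝔸.fst r ≤ 𝔸.imp g a :=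
  comp_le fst_le h

theorem comp_snd_le (h : r ≤ 𝔸.imp g (𝔸.itimes a b)) : 𝔸.comp 𝔸.snd r ≤ 𝔸.imp g b :=
  comp_le snd_le h

theorem curry_le (h : r ≤ 𝔸.imp (𝔸.itimes g a) b) : 𝔸.curry r ≤ 𝔸.imp g (𝔸.imp a b) :=
  comp_le (app_cS_le (const_le h)) mkPair_le

theorem le_imp_of_le_imp_iInf {ι : Sort v} {f : ι → A} (h : r ≤ 𝔸.imp g (⨅ i, f i)) (i : ι) :
    r ≤ 𝔸.imp g (f i) :=
  h.trans (𝔸.imp_mono (iInf_le f i))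

theorem le_imp_iInf {ι : Sort v} {f : ι → A} (h : ∀ i, r ≤ 𝔸.imp g (f i)) :
    r ≤ 𝔸.imp g (⨅ i, f i) := by
  rw [imp_iInf]
  exact le_iInf h

theorem comp_evalAt_le_iexists {ι : Sort v} {f : ι → A} (i : ι) (h : r ≤ 𝔸.imp g (f i)) :
    𝔸.comp 𝔸.evalAt r ≤ 𝔸.imp g (𝔸.iexists f) :=
  le_imp_iInf fun _ =>
    comp_le (evalAt_le.trans (𝔸.imp_mono (𝔸.imp_anti (iInf_le _ i)))) h

theorem ap_curry_le_of_iexists {ι : Sort v} {f : ι → A} (hr : r ≤ 𝔸.imp g (𝔸.iexists f))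
    (hq : ∀ i, q ≤ 𝔸.imp (𝔸.itimes g (f i)) x) : 𝔸.ap r (𝔸.curry q) ≤ 𝔸.imp g x :=
  ap_le (le_imp_of_le_imp_iInf hr x) (le_imp_iInf fun i => curry_le (hq i))

theorem selfApp_le : 𝔸.app (𝔸.selfApp r) a ≤ 𝔸.app r (𝔸.app a a) := by
  have h : a ≤ 𝔸.imp a (𝔸.app a a) := 𝔸.app_le_iff.1 le_rfl
  exact 𝔸.app_le_iff.2 (comp_le (𝔸.app_le_iff.1 le_rfl)
    (ap_le (ident_le.trans (𝔸.imp_mono h)) ident_le))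

theorem fixpoint_le : 𝔸.fixpoint r ≤ 𝔸.app r (𝔸.fixpoint r) := selfApp_le

end Rules

end ImplicativeAlgebra

namespace Name

open ImplicativeAlgebra

variable {A : Type u} [CompleteLattice A] (𝔸 : ImplicativeAlgebra A)

theorem eqPair_swap (α β : Name A) : (eqPair 𝔸 α β).swap = eqPair 𝔸 β α := by
  induction α generalizing β with
  | mk ι e v ih =>
    cases β with
    | mk ι' e' v' => simp only [eqPair, ← ih, Prod.swap_prod_mk, Prod.fst_swap, Prod.snd_swap]

theorem eqW_eq (α β : Name A) : eqW 𝔸 α β = 𝔸.itimes (subW 𝔸 α β) (subW 𝔸 β α) := by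
  rw [eqW, subW, subW, ← eqPair_swap 𝔸 α β, Prod.fst_swap]

theorem subW_eq (α β : Name A) :
    subW 𝔸 α β = ⨅ i, 𝔸.imp (α.val i) (memW 𝔸 (α.elem i) β) := by
  cases α with
  | mk ι e v =>
    cases β with
    | mk ι' e' v' =>
      change (eqPair 𝔸 (mk ι e v) (mk ι' e' v')).1 =
        ⨅ i : ι, 𝔸.imp (v i) (𝔸.iexists fun j : ι' => 𝔸.itimes (v' j)
          (𝔸.itimes (eqPair 𝔸 (e' j) (e i)).1 (eqPair 𝔸 (e' j) (e i)).2))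
      have h (i : ι) (j : ι') : eqPair 𝔸 (e' j) (e i) = (eqPair 𝔸 (e i) (e' j)).swap :=
        (eqPair_swap 𝔸 (e i) (e' j)).symm
      simp only [h, eqPair, Prod.fst_swap, Prod.snd_swap]

/-- Transitivity of equality at `α` as the middle term. -/
def transAt (α : Name A) : A :=
  ⨅ γ : Name A, ⨅ β : Name A,
    𝔸.imp (𝔸.itimes (eqW 𝔸 γ α) (eqW 𝔸 α β)) (eqW 𝔸 γ β)

theorem transAt_le (α β γ : Name A) :
    transAt 𝔸 α ≤ 𝔸.imp (𝔸.itimes (eqW 𝔸 γ α) (eqW 𝔸 α β)) (eqW 𝔸 γ β) :=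
  (iInf_le _ γ).trans (iInf_le _ β)

theorem fixpoint_le_of_forall_elem {r : A} (φ : Name A → A)
    (h : ∀ α : Name A, r ≤ 𝔸.imp (⨅ i, φ (α.elem i)) (φ α)) (α : Name A) :
    𝔸.fixpoint r ≤ φ α := by
  induction α with
  | mk ι e v ih =>
    exact fixpoint_le.trans (𝔸.app_le_iff.2 ((h _).trans (𝔸.imp_anti (le_iInf ih))))

/-- Realizer of `γ ∈ β` from transitivity below `α`, `α ⊆ β` and `γ ∈ α`. -/
def memOfSub : A :=
  𝔸.ap (𝔸.comp 𝔸.snd 𝔸.snd) <| 𝔸.curry <|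
    𝔸.ap (𝔸.ap (𝔸.comp 𝔸.fst (𝔸.comp 𝔸.snd 𝔸.fst)) (𝔸.comp 𝔸.fst 𝔸.snd)) <| 𝔸.curry <|
      𝔸.comp 𝔸.evalAt <| 𝔸.pair (𝔸.comp 𝔸.fst 𝔸.snd) <|
        𝔸.ap (𝔸.comp 𝔸.fst (𝔸.comp 𝔸.fst 𝔸.fst))
          (𝔸.pair (𝔸.comp 𝔸.snd 𝔸.snd) (𝔸.comp 𝔸.snd (𝔸.comp 𝔸.snd 𝔸.fst)))

theorem memOfSub_mem : memOfSub 𝔸 ∈ 𝔸.Sep := by simp (maxDischargeDepth := 20) [memOfSub]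

theorem memOfSub_le (α β γ : Name A) :
    memOfSub 𝔸 ≤ 𝔸.imp (𝔸.itimes (⨅ i, transAt 𝔸 (α.elem i))
      (𝔸.itimes (subW 𝔸 α β) (memW 𝔸 γ α))) (memW 𝔸 γ β) := by
  refine ap_curry_le_of_iexists (comp_snd_le snd_le) fun j => ?_
  have hsub := comp_fst_le (𝔸 := 𝔸) (comp_snd_le (fst_le
    (a := 𝔸.itimes (⨅ i, transAt 𝔸 (α.elem i)) (𝔸.itimes (subW 𝔸 α β) (memW 𝔸 γ α)))
    (b := 𝔸.itimes (α.val j) (eqW 𝔸 (α.elem j) γ))))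
  rw [subW_eq] at hsub
  rw [subW_eq]
  refine ap_curry_le_of_iexists
    (ap_le (le_imp_of_le_imp_iInf hsub j) (comp_fst_le snd_le)) fun k => ?_
  refine comp_evalAt_le_iexists k (pair_le (comp_fst_le snd_le) (ap_le ?_
    (pair_le (comp_snd_le snd_le) (comp_snd_le (comp_snd_le fst_le)))))
  exact (le_imp_of_le_imp_iInf (comp_fst_le (comp_fst_le fst_le)) j).trans
    (𝔸.imp_mono (transAt_le 𝔸 (α.elem j) γ (β.elem k)))

/-- Realizer of `γ ⊆ β` from transitivity below `α`, `γ ⊆ α` and `α ⊆ β`. -/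
def subTrans : A :=
  𝔸.curry <| 𝔸.comp (memOfSub 𝔸) <| 𝔸.pair (𝔸.comp 𝔸.fst 𝔸.fst) <|
    𝔸.pair (𝔸.comp 𝔸.snd (𝔸.comp 𝔸.snd 𝔸.fst))
      (𝔸.ap (𝔸.comp 𝔸.fst (𝔸.comp 𝔸.snd 𝔸.fst)) 𝔸.snd)

theorem subTrans_mem : subTrans 𝔸 ∈ 𝔸.Sep := by simp (maxDischargeDepth := 20) [subTrans, memOfSub_mem]

theorem subTrans_le (α β γ : Name A) :
    subTrans 𝔸 ≤ 𝔸.imp (𝔸.itimes (⨅ i, transAt 𝔸 (α.elem i))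
      (𝔸.itimes (subW 𝔸 γ α) (subW 𝔸 α β))) (subW 𝔸 γ β) := by
  rw [subW_eq 𝔸 γ β, subW_eq 𝔸 γ α]
  refine le_imp_iInf fun i => curry_le (comp_le (memOfSub_le 𝔸 α β (γ.elem i))
    (pair_le (comp_fst_le fst_le) (pair_le (comp_snd_le (comp_snd_le fst_le)) (ap_le ?_ snd_le))))
  exact le_imp_of_le_imp_iInf (comp_fst_le (comp_snd_le fst_le)) i

/-- Realizer of the induction step for transitivity of equality. -/
def eqTransStep : A :=
  𝔸.curry <| 𝔸.pair
    (𝔸.comp (subTrans 𝔸) <| 𝔸.pair 𝔸.fst <|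
      𝔸.pair (𝔸.comp 𝔸.fst (𝔸.comp 𝔸.fst 𝔸.snd)) (𝔸.comp 𝔸.fst (𝔸.comp 𝔸.snd 𝔸.snd)))
    (𝔸.comp (subTrans 𝔸) <| 𝔸.pair 𝔸.fst <|
      𝔸.pair (𝔸.comp 𝔸.snd (𝔸.comp 𝔸.snd 𝔸.snd)) (𝔸.comp 𝔸.snd (𝔸.comp 𝔸.fst 𝔸.snd)))

theorem eqTransStep_le (α : Name A) :
    eqTransStep 𝔸 ≤ 𝔸.imp (⨅ i, transAt 𝔸 (α.elem i)) (transAt 𝔸 α) := by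
  refine le_imp_iInf fun γ => le_imp_iInf fun β => curry_le ?_
  simp only [eqW_eq]
  exact pair_le
    (comp_le (subTrans_le 𝔸 α β γ) (pair_le fst_le
      (pair_le (comp_fst_le (comp_fst_le snd_le)) (comp_fst_le (comp_snd_le snd_le)))))
    (comp_le (subTrans_le 𝔸 α γ β) (pair_le fst_le
      (pair_le (comp_snd_le (comp_snd_le snd_le)) (comp_snd_le (comp_fst_le snd_le)))))

/-- Realizer of transitivity of equality. -/
def eqTrans : A := 𝔸.fixpoint (eqTransStep 𝔸)

theorem eqTrans_mem : eqTrans 𝔸 ∈ 𝔸.Sep := by simp (maxDischargeDepth := 20) [eqTrans, eqTransStep, subTrans_mem]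

theorem eqTrans_le_transAt (α : Name A) : eqTrans 𝔸 ≤ transAt 𝔸 α :=
  fixpoint_le_of_forall_elem 𝔸 (transAt 𝔸) (eqTransStep_le 𝔸) α

theorem eqTrans_le (α β γ : Name A) :
    eqTrans 𝔸 ≤ 𝔸.imp (𝔸.itimes (eqW 𝔸 γ α) (eqW 𝔸 α β)) (eqW 𝔸 γ β) :=
  (eqTrans_le_transAt 𝔸 α).trans (transAt_le 𝔸 α β γ)

end Name

open ImplicativeAlgebra

/-- there exist realizers s₁, s₂, s₃ ∈ Σ for the compatibility of
equality with membership (on both sides) and for transitivity of equality. -/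
theorem eqW_memW_compat_realized {A : Type u} [CompleteLattice A]
    (𝔸 : ImplicativeAlgebra A) :
    ∃ s1 ∈ 𝔸.Sep, ∃ s2 ∈ 𝔸.Sep, ∃ s3 ∈ 𝔸.Sep,
      s1 ≤ (⨅ α : Name A, ⨅ β : Name A, ⨅ γ : Name A,
        𝔸.imp (𝔸.itimes (Name.eqW 𝔸 α β) (Name.memW 𝔸 γ α)) (Name.memW 𝔸 γ β)) ∧
      s2 ≤ (⨅ α : Name A, ⨅ β : Name A, ⨅ γ : Name A,
        𝔸.imp (𝔸.itimes (Name.eqW 𝔸 α β) (Name.memW 𝔸 α γ)) (Name.memW 𝔸 β γ)) ∧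
      s3 ≤ (⨅ α : Name A, ⨅ β : Name A, ⨅ γ : Name A,
        𝔸.imp (𝔸.itimes (Name.eqW 𝔸 α β) (Name.eqW 𝔸 γ α)) (Name.eqW 𝔸 γ β)) := by
  refine ⟨𝔸.comp (Name.memOfSub 𝔸) (𝔸.pair (𝔸.const (Name.eqTrans 𝔸))
      (𝔸.pair (𝔸.comp 𝔸.fst 𝔸.fst) 𝔸.snd)), ?_,
    𝔸.ap 𝔸.snd (𝔸.curry (𝔸.comp 𝔸.evalAt (𝔸.pair (𝔸.comp 𝔸.fst 𝔸.snd)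
      (𝔸.comp (Name.eqTrans 𝔸)
        (𝔸.pair (𝔸.comp 𝔸.snd 𝔸.snd) (𝔸.comp 𝔸.fst 𝔸.fst)))))), ?_,
    𝔸.comp (Name.eqTrans 𝔸) (𝔸.pair 𝔸.snd 𝔸.fst), ?_,
    le_iInf fun α => le_iInf fun β => le_iInf fun γ => ?_,
    le_iInf fun α => le_iInf fun β => le_iInf fun γ => ?_,
    le_iInf fun α => le_iInf fun β => le_iInf fun γ => ?_⟩
  · simp (maxDischargeDepth := 20) [Name.memOfSub_mem, Name.eqTrans_mem]
  · simp (maxDischargeDepth := 20) [Name.eqTrans_mem]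
  · simp (maxDischargeDepth := 20) [Name.eqTrans_mem]
  · rw [Name.eqW_eq]
    exact comp_le (Name.memOfSub_le 𝔸 α β γ) (pair_le
      (const_le (le_iInf fun i => Name.eqTrans_le_transAt 𝔸 (α.elem i)))
      (pair_le (comp_fst_le fst_le) snd_le))
  · exact ap_curry_le_of_iexists snd_le fun j => comp_evalAt_le_iexists j
      (pair_le (comp_fst_le snd_le) (comp_le (Name.eqTrans_le 𝔸 α β (γ.elem j))
        (pair_le (comp_snd_le snd_le) (comp_fst_le fst_le))))
  · exact comp_le (Name.eqTrans_le 𝔸 α β γ) (pair_le snd_le fst_le)
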